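/- The 9×9 symmetric matrix M with entries M = (1/2)·[[4,0,1,-1,0,2,-1,0,1],[0,4,-1,-2,0,2,-2,0,0],[1,-1,4,0,-1,1,-1,1,2],[-1,-2,0,4,-1,-1,1,0,0],[0,0,-1,-1,4,1,0,-2,0],[2,2,1,-1,1,4,-2,-1,1],[-1,-2,-1,1,0,-2,4,1,0],[0,0,1,0,-2,-1,1,4,1],[1,0,2,0,0,1,0,1,4]] has determinant 115/16 and is positive definite. -/

import Mathlib

open Matrix

def M : Matrix (Fin 9) (Fin 9) ℚ :=
  (1 / 2 : ℚ) •
    !![4, 0, 1, -1, 0, 2, -1, 0, 1;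
       0, 4, -1, -2, 0, 2, -2, 0, 0;
       1, -1, 4, 0, -1, 1, -1, 1, 2;
       -1, -2, 0, 4, -1, -1, 1, 0, 0;
       0, 0, -1, -1, 4, 1, 0, -2, 0;
       2, 2, 1, -1, 1, 4, -2, -1, 1;
       -1, -2, -1, 1, 0, -2, 4, 1, 0;
       0, 0, 1, 0, -2, -1, 1, 4, 1;
       1, 0, 2, 0, 0, 1, 0, 1, 4]


/-- The unit lower triangular factor of the `L D Lᵀ` decomposition of `M`. -/
def gramL : Matrix (Fin 9) (Fin 9) ℚ :=
  !![1, 0, 0, 0, 0, 0, 0, 0, 0;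
     0, 1, 0, 0, 0, 0, 0, 0, 0;
     1/4, -1/4, 1, 0, 0, 0, 0, 0, 0;
     -1/4, -1/2, -1/14, 1, 0, 0, 0, 0, 0;
     0, 0, -2/7, -20/51, 1, 0, 0, 0, 0;
     1/2, 1/2, 2/7, 32/153, 11/24, 1, 0, 0, 0;
     -1/4, -1/2, -5/14, -19/153, -25/168, 11/65, 1, 0, 0;
     0, 0, 2/7, 4/153, -43/84, -38/65, 137/246, 1, 0;
     1/4, 0, 1/2, 7/51, 11/56, -27/65, 1/2, 0, 1]

/-- The diagonal of pivots. -/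
def gramD : Fin 9 → ℚ :=
  ![2, 2, 7/4, 153/112, 28/17, 65/144, 492/455, 115/123, 1]

theorem M_eq : M = gramL * diagonal gramD * gramLᴴ := by
  ext i j
  rw [Matrix.mul_apply]
  simp only [Matrix.mul_diagonal, conjTranspose_apply, star_trivial]
  fin_cases i <;> fin_cases j <;>
    simp [M, gramL, gramD, Fin.sum_univ_succ] <;> norm_num

theorem gramL_det : gramL.det = 1 := by
  rw [Matrix.det_of_isLowerTriangular]
  · simp [gramL, Fin.prod_univ_succ]
  · intro i j h
    fin_cases i <;> fin_cases j <;> first | rfl | (exfalso; revert h; decide)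

theorem gramD_pos (i : Fin 9) : 0 < gramD i := by
  fin_cases i <;> norm_num [gramD]

/-- The Gram matrix of the nine Mordell–Weil generators has determinant `115/16`
and is positive definite. -/
theorem gram_det_and_posDef : M.det = 115 / 16 ∧ M.PosDef := by
  constructor
  · rw [M_eq, det_mul, det_mul, det_conjTranspose, gramL_det, det_diagonal]
    simp [gramD, Fin.prod_univ_succ]
    norm_num
  · rw [M_eq]
    refine (PosDef.diagonal gramD_pos).mul_mul_conjTranspose_same ?_
    exact Matrix.vecMul_injective_of_isUnit
      ((Matrix.isUnit_iff_isUnit_det _).2 (by rw [gramL_det]; exact isUnit_one))
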